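/- arXiv:2009.12986 — 5 statements merged into one kernel-verified Lean document; each statement's English description precedes it below -/
import Mathlib

section
/- Let n ≥ 2 be an integer and let N, ε be real numbers with N ≠ 1, N ≠ n and (N−n)/(N−1) > 0, and set c := (1/(n−1))·(1 − ε²·(N−n)/(N−1)). Let h : (0,1) → ℝ be twice differentiable, φ : (0,1) → ℝ be twice continuously differentiable, and K : (0,1) → ℝ, and assume that h''(t) ≤ −h'(t)²/(n−1) − K(t) for all t ∈ (0,1). Set l := h − φ. Then for every t ∈ (0,1) the function t ↦ e^{2(1−ε)φ(t)/(n−1)}·l'(t) is differentiable at t and its derivative satisfies (e^{2(1−ε)φ/(n−1)}·l')'(t) ≤ −e^{2(1−ε)φ(t)/(n−1)}·( c·l'(t)² + K(t) + φ''(t) − φ'(t)²/(N−n) ). -/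
open Set

/-- The completed square behind the weighted Riccati comparison. -/
lemma weighted_riccati_square_le {m d ε a p : ℝ} (hm : 0 < m) (hd : d ≠ 0)
    (hdm : d + m ≠ 0) (hpos : 0 < d / (d + m)) :
    2 * (1 - ε) * p / m * a - (a + p) ^ 2 / m ≤
      -(1 / m * (1 - ε ^ 2 * d / (d + m)) * a ^ 2 - p ^ 2 / d) := by
  have key : 2 * (1 - ε) * p / m * a - (a + p) ^ 2 / m
      + (1 / m * (1 - ε ^ 2 * d / (d + m)) * a ^ 2 - p ^ 2 / d)
      = -((p + ε * (d / (d + m)) * a) ^ 2 / (m * (d / (d + m)))) := by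
    field_simp
    ring
  have : 0 ≤ (p + ε * (d / (d + m)) * a) ^ 2 / (m * (d / (d + m))) := by positivity
  linarith

/-- One-dimensional analytic content of Lemma 3.3: if `h'' ≤ -h'²/(n-1) - K` on `(0,1)`,
`φ` is `C²`, and `l := h - φ`, then `t ↦ e^{2(1-ε)φ(t)/(n-1)}·l'(t)` is differentiable on
`(0,1)` with derivative at most
`-e^{2(1-ε)φ(t)/(n-1)}·(c·l'(t)² + K(t) + φ''(t) - φ'(t)²/(N-n))`,
where `c = (1/(n-1))·(1 - ε²·(N-n)/(N-1))`. -/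
theorem stmt_1 (n : ℕ) (hn : 2 ≤ n) (N ε : ℝ) (hN1 : N ≠ 1) (hNn : N ≠ (n : ℝ))
    (hpos : (N - n) / (N - 1) > 0)
    (c : ℝ) (hc : c = (1 / ((n : ℝ) - 1)) * (1 - ε ^ 2 * (N - n) / (N - 1)))
    (h φ K : ℝ → ℝ)
    (hh1 : ∀ t ∈ Ioo (0 : ℝ) 1, DifferentiableAt ℝ h t)
    (hh2 : ∀ t ∈ Ioo (0 : ℝ) 1, DifferentiableAt ℝ (deriv h) t)
    (hφ : ContDiffOn ℝ 2 φ (Ioo (0 : ℝ) 1))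
    (hRic : ∀ t ∈ Ioo (0 : ℝ) 1,
      deriv (deriv h) t ≤ -(deriv h t) ^ 2 / ((n : ℝ) - 1) - K t)
    (l : ℝ → ℝ) (hl : l = fun t => h t - φ t) :
    ∀ t ∈ Ioo (0 : ℝ) 1,
      DifferentiableAt ℝ
        (fun s => Real.exp (2 * (1 - ε) * φ s / ((n : ℝ) - 1)) * deriv l s) t ∧
      deriv (fun s => Real.exp (2 * (1 - ε) * φ s / ((n : ℝ) - 1)) * deriv l s) t
        ≤ -Real.exp (2 * (1 - ε) * φ t / ((n : ℝ) - 1)) *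
            (c * (deriv l t) ^ 2 + K t + deriv (deriv φ) t
              - (deriv φ t) ^ 2 / (N - n)) := by
  intro t ht
  subst hl
  have hm : (0 : ℝ) < (n : ℝ) - 1 := by
    have : (2 : ℝ) ≤ n := by exact_mod_cast hn
    linarith
  have hφ1 : ∀ s ∈ Ioo (0 : ℝ) 1, DifferentiableAt ℝ φ s := fun s hs =>
    (hφ.differentiableOn (by norm_num)).differentiableAt (isOpen_Ioo.mem_nhds hs)
  have hφ2 : DifferentiableAt ℝ (deriv φ) t :=
    ((hφ.deriv_of_isOpen (m := 1) isOpen_Ioo (by norm_num)).differentiableOn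
      (by norm_num)).differentiableAt (isOpen_Ioo.mem_nhds ht)
  have hl1 : ∀ s ∈ Ioo (0 : ℝ) 1, deriv (fun t => h t - φ t) s = deriv h s - deriv φ s :=
    fun s hs => deriv_fun_sub (hh1 s hs) (hφ1 s hs)
  have hl2 : HasDerivAt (deriv fun t => h t - φ t)
      (deriv (deriv h) t - deriv (deriv φ) t) t :=
    ((hh2 t ht).hasDerivAt.sub hφ2.hasDerivAt).congr_of_eventuallyEq
      (Filter.eventually_of_mem (isOpen_Ioo.mem_nhds ht) hl1)
  have hderiv := ((((hφ1 t ht).hasDerivAt.const_mul (2 * (1 - ε))).div_const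
    ((n : ℝ) - 1)).exp).fun_mul hl2
  refine ⟨hderiv.differentiableAt, ?_⟩
  rw [hderiv.deriv, hl1 t ht, hc]
  have hN : N - n + ((n : ℝ) - 1) = N - 1 := by ring
  have hsq := weighted_riccati_square_le (d := N - n) (ε := ε)
    (a := deriv h t - deriv φ t) (p := deriv φ t) hm (sub_ne_zero.mpr hNn)
    (hN ▸ sub_ne_zero.mpr hN1) (hN ▸ hpos)
  rw [hN, sub_add_cancel] at hsq
  have hR := hRic t ht
  rw [neg_div] at hR
  rw [mul_assoc (Real.exp _), ← mul_add, neg_mul, ← mul_neg]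
  refine mul_le_mul_of_nonneg_left ?_ (Real.exp_pos _).le
  linarith
end

section
/- Let c > 0 and α ∈ ℝ. Let φ : [0,1] → ℝ be twice continuously differentiable, l : [0,1] → ℝ be twice continuously differentiable, and G : [0,1] → ℝ be continuous. Define s(t) := ∫₀^t e^{−α·φ(ξ)} dξ, set a := s(1) > 0, and let τ : [0,a] → [0,1] be the inverse function of s. Assume that (e^{α·φ}·l')'(t) ≤ −e^{α·φ(t)}·( c·l'(t)² + G(t) ) for all t ∈ (0,1). Then the function D̂ : [0,a] → ℝ defined by D̂(σ) := exp(c·l(τ(σ))) is twice differentiable on (0,a) and satisfies D̂''(σ) ≤ −c·e^{2α·φ(τ(σ))}·G(τ(σ))·D̂(σ) for all σ ∈ (0,a). -/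
open Set intervalIntegral

/-- On `(0, 1)` the primitive of a function continuous on `[0, 1]` has that function as derivative. -/
theorem hasDerivAt_primitive_of_continuousOn_Icc {f : ℝ → ℝ} (hf : ContinuousOn f (Icc (0 : ℝ) 1))
    {t : ℝ} (ht : t ∈ Ioo (0 : ℝ) 1) :
    HasDerivAt (fun t => ∫ ξ in (0 : ℝ)..t, f ξ) (f t) t := by
  have hnhds : Icc (0 : ℝ) 1 ∈ nhds t := Icc_mem_nhds ht.1 ht.2
  refine integral_hasDerivAt_right ?_ ?_ (hf.continuousAt hnhds)
  · refine (hf.mono ?_).intervalIntegrable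
    rw [uIcc_of_le ht.1.le]
    exact Icc_subset_Icc_right ht.2.le
  · exact (hf.mono Ioo_subset_Icc_self).stronglyMeasurableAtFilter isOpen_Ioo t ht

/-- The primitive of a positive continuous function on `[0, 1]` is strictly increasing. -/
theorem strictMonoOn_primitive_of_pos {f : ℝ → ℝ} (hf : ContinuousOn f (Icc (0 : ℝ) 1))
    (hpos : ∀ t, 0 < f t) :
    StrictMonoOn (fun t => ∫ ξ in (0 : ℝ)..t, f ξ) (Icc (0 : ℝ) 1) := by
  refine strictMonoOn_of_deriv_pos (convex_Icc 0 1) ?_ fun t ht => ?_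
  · have h := continuousOn_primitive_interval (μ := MeasureTheory.volume) (f := f) (a := 0) (b := 1)
    rw [uIcc_of_le zero_le_one] at h
    exact h hf.integrableOn_Icc
  · rw [interior_Icc] at ht
    rw [(hasDerivAt_primitive_of_continuousOn_Icc hf ht).deriv]
    exact hpos t

/-- An inverse of a strictly increasing function on `[0, 1]` maps the open interval of values into
`(0, 1)` and is continuous there. -/
theorem StrictMonoOn.inverse_mem_Ioo_and_continuousAt {s τ : ℝ → ℝ} {a : ℝ}
    (hs : StrictMonoOn s (Icc (0 : ℝ) 1)) (hs0 : s 0 = 0) (hs1 : s 1 = a)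
    (hτmem : ∀ σ ∈ Icc 0 a, τ σ ∈ Icc (0 : ℝ) 1)
    (hτs : ∀ t ∈ Icc (0 : ℝ) 1, τ (s t) = t)
    (hsτ : ∀ σ ∈ Icc 0 a, s (τ σ) = σ) {σ : ℝ} (hσ : σ ∈ Ioo 0 a) :
    τ σ ∈ Ioo (0 : ℝ) 1 ∧ ContinuousAt τ σ := by
  have h0 : (0 : ℝ) ∈ Icc (0 : ℝ) 1 := left_mem_Icc.2 zero_le_one
  have h1 : (1 : ℝ) ∈ Icc (0 : ℝ) 1 := right_mem_Icc.2 zero_le_one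
  have hσ' := Ioo_subset_Icc_self hσ
  have hmem : τ σ ∈ Ioo (0 : ℝ) 1 := by
    constructor
    · rw [← hs.lt_iff_lt h0 (hτmem σ hσ'), hs0, hsτ σ hσ']
      exact hσ.1
    · rw [← hs.lt_iff_lt (hτmem σ hσ') h1, hs1, hsτ σ hσ']
      exact hσ.2
  refine ⟨hmem, continuousAt_of_monotoneOn_of_image_mem_nhds (s := Icc 0 a) ?_
    (Icc_mem_nhds hσ.1 hσ.2) ?_⟩
  · intro x hx y hy hxy
    rwa [← hs.le_iff_le (hτmem x hx) (hτmem y hy), hsτ x hx, hsτ y hy]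
  · refine Filter.mem_of_superset (Icc_mem_nhds hmem.1 hmem.2) fun t ht => ⟨s t, ⟨?_, ?_⟩, hτs t ht⟩
    · rw [← hs0]
      exact hs.monotoneOn h0 ht ht.1
    · rw [← hs1]
      exact hs.monotoneOn ht h1 ht.2

/-- Reparametrization step in the proof of Lemma 3.5: re-parametrizing by the weighted
arclength `s(t) = ∫₀ᵗ e^{-αφ}`, with inverse `τ`, converts the weighted Riccati
inequality `(e^{αφ} l')' ≤ -e^{αφ}(c l'² + G)` into the linear second-order differential
inequality `D̂'' ≤ -c e^{2αφ∘τ} (G∘τ) D̂` for `D̂ = exp(c·(l∘τ))` on `(0,a)`. -/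
theorem stmt_2 (c α : ℝ) (hc : 0 < c)
    (φ l G : ℝ → ℝ)
    (hφ : ContDiffOn ℝ 2 φ (Icc (0 : ℝ) 1))
    (hl : ContDiffOn ℝ 2 l (Icc (0 : ℝ) 1))
    (hG : ContinuousOn G (Icc (0 : ℝ) 1))
    (s : ℝ → ℝ) (hs : s = fun t => ∫ ξ in (0 : ℝ)..t, Real.exp (-α * φ ξ))
    (a : ℝ) (ha : a = s 1) (ha0 : 0 < a)
    (τ : ℝ → ℝ)
    (hτmem : ∀ σ ∈ Icc 0 a, τ σ ∈ Icc (0 : ℝ) 1)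
    (hτs : ∀ t ∈ Icc (0 : ℝ) 1, τ (s t) = t)
    (hsτ : ∀ σ ∈ Icc 0 a, s (τ σ) = σ)
    (hRic : ∀ t ∈ Ioo (0 : ℝ) 1,
      deriv (fun u => Real.exp (α * φ u) * deriv l u) t
        ≤ -Real.exp (α * φ t) * (c * (deriv l t) ^ 2 + G t)) :
    ∀ σ ∈ Ioo 0 a,
      DifferentiableAt ℝ (fun u => Real.exp (c * l (τ u))) σ ∧
      DifferentiableAt ℝ (deriv (fun u => Real.exp (c * l (τ u)))) σ ∧
      deriv (deriv (fun u => Real.exp (c * l (τ u)))) σ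
        ≤ -c * Real.exp (2 * α * φ (τ σ)) * G (τ σ) * Real.exp (c * l (τ σ)) := by
  have hf : ContinuousOn (fun ξ => Real.exp (-α * φ ξ)) (Icc (0 : ℝ) 1) :=
    (continuousOn_const.mul hφ.continuousOn).rexp
  have hmono : StrictMonoOn s (Icc (0 : ℝ) 1) :=
    hs ▸ strictMonoOn_primitive_of_pos hf fun t => Real.exp_pos _
  have hinv : ∀ σ ∈ Ioo 0 a, τ σ ∈ Ioo (0 : ℝ) 1 ∧ ContinuousAt τ σ := fun σ hσ =>
    hmono.inverse_mem_Ioo_and_continuousAt (by simp [hs]) ha.symm hτmem hτs hsτ hσ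
  have hτ : ∀ σ ∈ Ioo 0 a, HasDerivAt τ (Real.exp (α * φ (τ σ))) σ := by
    intro σ hσ
    have hd : HasDerivAt s (Real.exp (-α * φ (τ σ))) (τ σ) :=
      hs ▸ hasDerivAt_primitive_of_continuousOn_Icc hf (hinv σ hσ).1
    have h := hd.of_local_left_inverse (hinv σ hσ).2 (Real.exp_pos _).ne'
      (Filter.mem_of_superset (Icc_mem_nhds hσ.1 hσ.2) hsτ)
    rwa [← Real.exp_neg, neg_mul, neg_neg] at h
  have hφd : ∀ t ∈ Ioo (0 : ℝ) 1, DifferentiableAt ℝ φ t := fun t ht =>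
    (hφ.contDiffAt (Icc_mem_nhds ht.1 ht.2)).differentiableAt (by norm_num)
  have hld : ∀ t ∈ Ioo (0 : ℝ) 1, DifferentiableAt ℝ l t := fun t ht =>
    (hl.contDiffAt (Icc_mem_nhds ht.1 ht.2)).differentiableAt (by norm_num)
  have hl' : ∀ t ∈ Ioo (0 : ℝ) 1, DifferentiableAt ℝ (deriv l) t := fun t ht =>
    (((hl.mono Ioo_subset_Icc_self).deriv_of_isOpen (m := 1) isOpen_Ioo
      (by norm_num)).contDiffAt (isOpen_Ioo.mem_nhds ht)).differentiableAt (by norm_num)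
  set w : ℝ → ℝ := fun u => Real.exp (α * φ u) * deriv l u with hw
  have hwd : ∀ t ∈ Ioo (0 : ℝ) 1, DifferentiableAt ℝ w t := fun t ht =>
    ((hφd t ht).const_mul α).exp.mul (hl' t ht)
  have hD : ∀ σ ∈ Ioo 0 a, HasDerivAt (fun u => Real.exp (c * l (τ u)))
      (Real.exp (c * l (τ σ)) * (c * w (τ σ))) σ := by
    intro σ hσ
    have h := ((((hld _ (hinv σ hσ).1).hasDerivAt.comp σ (hτ σ hσ)).const_mul c).exp)
    refine h.congr_deriv ?_
    simp only [hw, Function.comp_apply]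
    ring
  intro σ hσ
  have hD' := (hD σ hσ).mul
    (((hwd _ (hinv σ hσ).1).hasDerivAt.comp σ (hτ σ hσ)).const_mul c)
  have hDD := hD'.congr_of_eventuallyEq (f₁ := deriv fun u => Real.exp (c * l (τ u)))
    (Filter.mem_of_superset (isOpen_Ioo.mem_nhds hσ) fun u hu => (hD u hu).deriv)
  refine ⟨(hD σ hσ).differentiableAt, hDD.differentiableAt, ?_⟩
  rw [hDD.deriv]
  have hR := mul_le_mul_of_nonneg_left (hRic _ (hinv σ hσ).1)
    (mul_pos (mul_pos hc (Real.exp_pos (c * l (τ σ)))) (Real.exp_pos (α * φ (τ σ)))).le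
  have he : Real.exp (2 * α * φ (τ σ)) = Real.exp (α * φ (τ σ)) ^ 2 := by
    rw [← Real.exp_nat_mul]
    push_cast
    ring_nf
  rw [he]
  simp only [Function.comp_apply]
  have hwτ : w (τ σ) = Real.exp (α * φ (τ σ)) * deriv l (τ σ) := rfl
  rw [hwτ]
  linarith
end

section
/- Let c > 0, κ ∈ ℝ, d > 0 and α ∈ ℝ. Let φ : [0,1] → ℝ and l : [0,1] → ℝ be twice continuously differentiable, and assume that (e^{α·φ}·l')'(t) ≤ −e^{α·φ(t)}·( c·l'(t)² + c^{−1}·κ·d²·e^{−2α·φ(t)} ) for all t ∈ (0,1). Define s(t) := ∫₀^t e^{−α·φ(ξ)} dξ and a := s(1), and assume κ·d² < π²/a². Then for every t ∈ (0,1), e^{c·l(t)} ≥ ( 𝔰_κ((a − s(t))·d) / 𝔰_κ(a·d) )·e^{c·l(0)} + ( 𝔰_κ(s(t)·d) / 𝔰_κ(a·d) )·e^{c·l(1)}. -/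
open Set intervalIntegral

/-- The comparison function `𝔰_κ`, the solution of `ψ'' + κψ = 0` with
`ψ(0) = 0`, `ψ'(0) = 1`. -/
noncomputable def sk (κ s : ℝ) : ℝ :=
  if 0 < κ then Real.sin (Real.sqrt κ * s) / Real.sqrt κ
  else if κ = 0 then s
  else Real.sinh (Real.sqrt |κ| * s) / Real.sqrt |κ|

/-- The derivative of `sk κ`. -/
noncomputable def ck (κ s : ℝ) : ℝ :=
  if 0 < κ then Real.cos (Real.sqrt κ * s) else Real.cosh (Real.sqrt |κ| * s)

theorem hasDerivAt_sk (κ x : ℝ) : HasDerivAt (sk κ) (ck κ x) x := by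
  rcases lt_trichotomy 0 κ with h | h | h
  · have hk : √κ ≠ 0 := (Real.sqrt_pos.2 h).ne'
    have h1 := (((hasDerivAt_id x).const_mul √κ).sin).div_const √κ
    have e : sk κ = fun s => Real.sin (√κ * s) / √κ := by
      funext s; simp [sk, h]
    rw [e]
    refine h1.congr_deriv ?_
    simp only [ck, h, if_true, id]
    field_simp
  · subst h
    have e : sk 0 = id := by funext s; simp [sk]
    rw [e]
    simpa [ck] using hasDerivAt_id x
  · have hk : √|κ| ≠ 0 := (Real.sqrt_pos.2 (abs_pos.2 h.ne)).ne'
    have h1 := (((hasDerivAt_id x).const_mul √|κ|).sinh).div_const √|κ|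
    have e : sk κ = fun s => Real.sinh (√|κ| * s) / √|κ| := by
      funext s; simp [sk, h.not_gt, h.ne]
    rw [e]
    refine h1.congr_deriv ?_
    simp only [ck, h.not_gt, if_false, id]
    field_simp

theorem hasDerivAt_ck (κ x : ℝ) : HasDerivAt (ck κ) (-κ * sk κ x) x := by
  rcases lt_trichotomy 0 κ with h | h | h
  · have hk : √κ ≠ 0 := (Real.sqrt_pos.2 h).ne'
    have h1 := ((hasDerivAt_id x).const_mul √κ).cos
    have e : ck κ = fun s => Real.cos (√κ * s) := by
      funext s; simp [ck, h]
    rw [e]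
    refine h1.congr_deriv ?_
    simp only [sk, h, if_true, id]
    field_simp
    rw [Real.sq_sqrt h.le]
    ring
  · subst h
    have e : ck 0 = fun _ => 1 := by funext s; simp [ck]
    rw [e]
    simpa using hasDerivAt_const x (1 : ℝ)
  · have hk : √|κ| ≠ 0 := (Real.sqrt_pos.2 (abs_pos.2 h.ne)).ne'
    have h1 := ((hasDerivAt_id x).const_mul √|κ|).cosh
    have e : ck κ = fun s => Real.cosh (√|κ| * s) := by
      funext s; simp [ck, h.not_gt]
    rw [e]
    refine h1.congr_deriv ?_
    simp only [sk, h.not_gt, h.ne, if_false, id]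
    field_simp
    rw [Real.sq_sqrt (abs_nonneg κ), abs_of_neg h]
    ring

theorem sk_zero (κ : ℝ) : sk κ 0 = 0 := by
  simp [sk]

theorem sk_pos {κ x : ℝ} (hx : 0 < x) (h : κ * x ^ 2 < Real.pi ^ 2) : 0 < sk κ x := by
  unfold sk
  split_ifs with h0 h1
  · have hk := Real.sqrt_pos.2 h0
    refine div_pos (Real.sin_pos_of_pos_of_lt_pi (by positivity) ?_) hk
    refine lt_of_pow_lt_pow_left₀ 2 Real.pi_pos.le ?_
    rwa [mul_pow, Real.sq_sqrt h0.le]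
  · exact hx
  · have hk := Real.sqrt_pos.2 (abs_pos.2 h1)
    exact div_pos (Real.sinh_pos_iff.2 (by positivity)) hk

theorem ck_pos {κ x : ℝ} (h : κ * x ^ 2 < (Real.pi / 2) ^ 2) : 0 < ck κ x := by
  unfold ck
  split_ifs with h0
  · refine Real.cos_pos_of_mem_Ioo (abs_lt.1 ?_)
    refine abs_lt_of_sq_lt_sq ?_ (by positivity)
    rwa [mul_pow, Real.sq_sqrt h0.le]
  · exact Real.cosh_pos _

/-- Comparison principle for `(w u')' + K u / w ≤ 0` with zero boundary values, in the presence
of a positive solution `h` of `(w h')' + K h / w = 0`. The functions `p` and `q` are the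
weighted derivatives of `u` and `h` with weight `w`. -/
theorem nonneg_of_sturm_supersolution {u h p q p' w : ℝ → ℝ} {K : ℝ}
    (hu : ContinuousOn u (Icc 0 1)) (hh : ContinuousOn h (Icc 0 1))
    (hpos : ∀ t ∈ Icc (0 : ℝ) 1, 0 < h t) (hw : ∀ t ∈ Ioo (0 : ℝ) 1, 0 < w t)
    (hu' : ∀ t ∈ Ioo (0 : ℝ) 1, HasDerivAt u (p t / w t) t)
    (hh' : ∀ t ∈ Ioo (0 : ℝ) 1, HasDerivAt h (q t / w t) t)
    (hp : ∀ t ∈ Ioo (0 : ℝ) 1, HasDerivAt p (p' t) t)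
    (hp' : ∀ t ∈ Ioo (0 : ℝ) 1, p' t ≤ -K * u t / w t)
    (hq : ∀ t ∈ Ioo (0 : ℝ) 1, HasDerivAt q (-K * h t / w t) t)
    (u0 : u 0 = 0) (u1 : u 1 = 0) {t : ℝ} (ht : t ∈ Ioo (0 : ℝ) 1) : 0 ≤ u t := by
  by_contra! hneg
  have hsub0 : Icc 0 t ⊆ Icc (0 : ℝ) 1 := Icc_subset_Icc_right ht.2.le
  have hsub1 : Icc t 1 ⊆ Icc (0 : ℝ) 1 := Icc_subset_Icc_left ht.1.le
  have hv : ContinuousOn (fun x => u x / h x) (Icc 0 1) :=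
    hu.div hh fun x hx => (hpos x hx).ne'
  have hvt : u t / h t < 0 := div_neg_of_neg_of_pos hneg (hpos t (Ioo_subset_Icc_self ht))
  have hv' : ∀ x ∈ Ioo (0 : ℝ) 1, HasDerivAt (fun x => u x / h x)
      ((p x * h x - u x * q x) / (w x * h x ^ 2)) x := by
    intro x hx
    have hx0 := (hpos x (Ioo_subset_Icc_self hx)).ne'
    have hw0 := (hw x hx).ne'
    refine ((hu' x hx).div (hh' x hx) hx0).congr_deriv ?_
    field_simp
  have hW' : ∀ x ∈ Ioo (0 : ℝ) 1, HasDerivAt (fun x => p x * h x - u x * q x)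
      ((p' x - -K * u x / w x) * h x) x := by
    intro x hx
    have hw0 := (hw x hx).ne'
    refine (((hp x hx).mul (hh' x hx)).sub ((hu' x hx).mul (hq x hx))).congr_deriv ?_
    field_simp
    ring
  have hanti : AntitoneOn (fun x => p x * h x - u x * q x) (Ioo 0 1) := by
    refine antitoneOn_of_deriv_nonpos (convex_Ioo 0 1)
      (fun x hx => (hW' x hx).continuousAt.continuousWithinAt) ?_ ?_
    · rw [interior_Ioo]
      exact fun x hx => (hW' x hx).differentiableAt.differentiableWithinAt
    · rw [interior_Ioo]
      intro x hx
      rw [(hW' x hx).deriv]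
      exact mul_nonpos_of_nonpos_of_nonneg (sub_nonpos.2 (hp' x hx))
        (hpos x (Ioo_subset_Icc_self hx)).le
  obtain ⟨y, hy, ey⟩ := exists_hasDerivAt_eq_slope _ _ ht.1 (hv.mono hsub0)
    fun x hx => hv' x ⟨hx.1, hx.2.trans ht.2⟩
  obtain ⟨z, hz, ez⟩ := exists_hasDerivAt_eq_slope _ _ ht.2 (hv.mono hsub1)
    fun x hx => hv' x ⟨ht.1.trans hx.1, hx.2⟩
  have hy1 : y ∈ Ioo (0 : ℝ) 1 := ⟨hy.1, hy.2.trans ht.2⟩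
  have hz1 : z ∈ Ioo (0 : ℝ) 1 := ⟨ht.1.trans hz.1, hz.2⟩
  have hden : ∀ x ∈ Ioo (0 : ℝ) 1, 0 < w x * h x ^ 2 := fun x hx =>
    mul_pos (hw x hx) (pow_pos (hpos x (Ioo_subset_Icc_self hx)) 2)
  have hyneg : p y * h y - u y * q y < 0 := by
    have : (p y * h y - u y * q y) / (w y * h y ^ 2) < 0 := by
      rw [ey, u0, zero_div, sub_zero, sub_zero]
      exact div_neg_of_neg_of_pos hvt ht.1
    rwa [div_lt_iff₀ (hden y hy1), zero_mul] at this
  have hzpos : 0 < p z * h z - u z * q z := by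
    have : 0 < (p z * h z - u z * q z) / (w z * h z ^ 2) := by
      rw [ez, u1, zero_div, zero_sub]
      exact div_pos (neg_pos.2 hvt) (sub_pos.2 ht.2)
    rwa [lt_div_iff₀ (hden z hz1), zero_mul] at this
  have := hanti hy1 hz1 (hy.2.trans hz.1).le
  simp only at this
  linarith

/-- One-dimensional analytic content of Lemma 3.5: if `l` satisfies the weighted Riccati
inequality `(e^{αφ} l')' ≤ -e^{αφ}(c l'² + c⁻¹ κ d² e^{-2αφ})` on `(0,1)`, then with
`s(t) = ∫₀ᵗ e^{-αφ}`, `a = s(1)` and `κd² < π²/a²`, the function `D(t) = e^{c·l(t)}`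
satisfies the `𝔰_κ`-concavity estimate
`D(t) ≥ (𝔰_κ((a-s(t))d)/𝔰_κ(ad))·D(0) + (𝔰_κ(s(t)d)/𝔰_κ(ad))·D(1)`. -/
theorem stmt_3 (c κ d α : ℝ) (hc : 0 < c) (hd : 0 < d)
    (φ l : ℝ → ℝ)
    (hφ : ContDiffOn ℝ 2 φ (Icc (0 : ℝ) 1))
    (hl : ContDiffOn ℝ 2 l (Icc (0 : ℝ) 1))
    (hRic : ∀ t ∈ Ioo (0 : ℝ) 1,
      deriv (fun u => Real.exp (α * φ u) * deriv l u) t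
        ≤ -Real.exp (α * φ t) *
            (c * (deriv l t) ^ 2 + c⁻¹ * κ * d ^ 2 * Real.exp (-2 * α * φ t)))
    (s : ℝ → ℝ) (hs : s = fun t => ∫ ξ in (0 : ℝ)..t, Real.exp (-α * φ ξ))
    (a : ℝ) (ha : a = s 1)
    (hκd : κ * d ^ 2 < Real.pi ^ 2 / a ^ 2) :
    ∀ t ∈ Ioo (0 : ℝ) 1,
      Real.exp (c * l t)
        ≥ (sk κ ((a - s t) * d) / sk κ (a * d)) * Real.exp (c * l 0)
          + (sk κ (s t * d) / sk κ (a * d)) * Real.exp (c * l 1) := by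
  have hφc : ContinuousOn φ (Icc 0 1) := hφ.continuousOn
  have hec : ContinuousOn (fun ξ => Real.exp (-α * φ ξ)) (Icc 0 1) :=
    Real.continuous_exp.comp_continuousOn (continuousOn_const.mul hφc)
  have hw : ∀ x, (Real.exp (α * φ x))⁻¹ = Real.exp (-α * φ x) := by
    intro x; rw [← Real.exp_neg, neg_mul]
  have hsc : ContinuousOn s (Icc 0 1) := by
    rw [hs]
    have := continuousOn_primitive_interval (μ := MeasureTheory.volume) (a := (0 : ℝ)) (b := 1)
      (f := fun ξ => Real.exp (-α * φ ξ)) (by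
        rw [uIcc_of_le zero_le_one]; exact hec.integrableOn_Icc)
    rwa [uIcc_of_le zero_le_one] at this
  have hs' : ∀ x ∈ Ioo (0 : ℝ) 1, HasDerivAt s (Real.exp (α * φ x))⁻¹ x := by
    intro x hx
    rw [hs, hw]
    refine integral_hasDerivAt_right ?_ ?_ ?_
    · refine ContinuousOn.intervalIntegrable ?_
      rw [uIcc_of_le hx.1.le]
      exact hec.mono (Icc_subset_Icc_right hx.2.le)
    · exact (hec.mono Ioo_subset_Icc_self).stronglyMeasurableAtFilter isOpen_Ioo x hx
    · exact hec.continuousAt (Icc_mem_nhds hx.1 hx.2)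
  have hs0 : s 0 = 0 := by simp [hs]
  have hmono : StrictMonoOn s (Icc 0 1) := by
    refine strictMonoOn_of_deriv_pos (convex_Icc 0 1) hsc fun x hx => ?_
    rw [interior_Icc] at hx
    rw [(hs' x hx).deriv]
    positivity
  have hapos : 0 < a := by
    rw [ha, ← hs0]
    exact hmono (by simp) (by simp) one_pos
  have hκa : κ * d ^ 2 * a ^ 2 < Real.pi ^ 2 := (lt_div_iff₀ (by positivity)).1 hκd
  have hSpos : 0 < sk κ (a * d) := sk_pos (by positivity) (by nlinarith)
  have hskc : Continuous (sk κ) :=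
    continuous_iff_continuousAt.2 fun x => (hasDerivAt_sk κ x).continuousAt
  have hckc : Continuous (ck κ) :=
    continuous_iff_continuousAt.2 fun x => (hasDerivAt_ck κ x).continuousAt
  have hd1 : ∀ x ∈ Ioo (0 : ℝ) 1,
      HasDerivAt (fun x => (a - s x) * d) (-(Real.exp (α * φ x))⁻¹ * d) x :=
    fun x hx => ((hs' x hx).const_sub a).mul_const d
  have hd2 : ∀ x ∈ Ioo (0 : ℝ) 1,
      HasDerivAt (fun x => s x * d) ((Real.exp (α * φ x))⁻¹ * d) x :=
    fun x hx => (hs' x hx).mul_const d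
  have hd3 : ∀ x ∈ Ioo (0 : ℝ) 1,
      HasDerivAt (fun x => (s x - a / 2) * d) ((Real.exp (α * φ x))⁻¹ * d) x :=
    fun x hx => ((hs' x hx).sub_const (a / 2)).mul_const d
  have hl' : ∀ x ∈ Ioo (0 : ℝ) 1, HasDerivAt l (deriv l x) x := fun x hx =>
    ((hl.contDiffAt (Icc_mem_nhds hx.1 hx.2)).differentiableAt (by norm_num)).hasDerivAt
  have hwl : ∀ x ∈ Ioo (0 : ℝ) 1,
      DifferentiableAt ℝ (fun u => Real.exp (α * φ u) * deriv l u) x := by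
    intro x hx
    have h1 : DifferentiableAt ℝ φ x :=
      (hφ.contDiffAt (Icc_mem_nhds hx.1 hx.2)).differentiableAt (by norm_num)
    have h2 : DifferentiableAt ℝ (deriv l) x :=
      ((hl.contDiffAt (Icc_mem_nhds hx.1 hx.2)).derivWithin (m := 1) (by norm_num)).differentiableAt
        (by norm_num)
    exact ((h1.const_mul α).exp).mul h2
  have hD : ∀ x ∈ Ioo (0 : ℝ) 1,
      HasDerivAt (fun x => Real.exp (c * l x)) (Real.exp (c * l x) * (c * deriv l x)) x :=
    fun x hx => ((hl' x hx).const_mul c).exp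
  intro t ht
  set A := Real.exp (c * l 0) / sk κ (a * d) with hA
  set B := Real.exp (c * l 1) / sk κ (a * d) with hB
  have key := nonneg_of_sturm_supersolution (K := κ * d ^ 2)
    (u := fun x => Real.exp (c * l x) - (sk κ ((a - s x) * d) * A + sk κ (s x * d) * B))
    (h := fun x => ck κ ((s x - a / 2) * d))
    (w := fun x => Real.exp (α * φ x))
    (p := fun x => c * Real.exp (c * l x) * (Real.exp (α * φ x) * deriv l x)
      - (-d * ck κ ((a - s x) * d) * A + d * ck κ (s x * d) * B))
    (q := fun x => d * (-κ * sk κ ((s x - a / 2) * d)))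
    (p' := fun x => c * (Real.exp (c * l x) * (c * deriv l x)) * (Real.exp (α * φ x) * deriv l x)
      + c * Real.exp (c * l x) * deriv (fun u => Real.exp (α * φ u) * deriv l u) x
      - (-d * (-κ * sk κ ((a - s x) * d) * (-(Real.exp (α * φ x))⁻¹ * d)) * A
        + d * (-κ * sk κ (s x * d) * ((Real.exp (α * φ x))⁻¹ * d)) * B))
    ?_ ?_ ?_ (fun x _ => Real.exp_pos _) ?_ ?_ ?_ ?_ ?_ ?_ ?_ ht
  · have e : ∀ X Y Z W V : ℝ, X / Y * Z + W / Y * V = X * (Z / Y) + W * (V / Y) := by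
      intros; ring
    rw [ge_iff_le, e]
    exact sub_nonneg.1 key
  · refine (Real.continuous_exp.comp_continuousOn (continuousOn_const.mul hl.continuousOn)).sub ?_
    refine ((hskc.comp_continuousOn ?_).mul continuousOn_const).add
      ((hskc.comp_continuousOn ?_).mul continuousOn_const)
    · exact (continuousOn_const.sub hsc).mul continuousOn_const
    · exact hsc.mul continuousOn_const
  · exact hckc.comp_continuousOn ((hsc.sub continuousOn_const).mul continuousOn_const)
  · intro x hx
    apply ck_pos
    have h0 : 0 ≤ s x := hs0 ▸ hmono.monotoneOn (by simp) hx hx.1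
    have h1 : s x ≤ a := ha ▸ hmono.monotoneOn hx (by simp) hx.2
    have h2 : (s x - a / 2) ^ 2 ≤ a ^ 2 / 4 := by nlinarith
    have hpi := Real.pi_pos
    rw [mul_pow]
    rcases le_or_gt κ 0 with hκ | hκ
    · have : κ * ((s x - a / 2) ^ 2 * d ^ 2) ≤ 0 :=
        mul_nonpos_of_nonpos_of_nonneg hκ (by positivity)
      have : 0 < (Real.pi / 2) ^ 2 := by positivity
      linarith
    · have := mul_le_mul_of_nonneg_left h2 (by positivity : 0 ≤ κ * d ^ 2)
      nlinarith
  · intro x hx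
    have hne := (Real.exp_pos (α * φ x)).ne'
    refine ((hD x hx).sub
      ((((hasDerivAt_sk κ _).comp x (hd1 x hx)).mul_const A).add
      (((hasDerivAt_sk κ _).comp x (hd2 x hx)).mul_const B))).congr_deriv ?_
    field_simp
  · intro x hx
    refine ((hasDerivAt_ck κ _).comp x (hd3 x hx)).congr_deriv ?_
    field_simp
  · intro x hx
    exact (((hD x hx).const_mul c).mul (hwl x hx).hasDerivAt).sub
      (((((hasDerivAt_ck κ _).comp x (hd1 x hx)).const_mul (-d)).mul_const A).add
      ((((hasDerivAt_ck κ _).comp x (hd2 x hx)).const_mul d).mul_const B))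
  · intro x hx
    have hR := hRic x hx
    have he : Real.exp (-2 * α * φ x) = (Real.exp (α * φ x))⁻¹ ^ 2 := by
      rw [hw, ← Real.exp_nat_mul]; congr 1; push_cast; ring
    rw [he] at hR
    have hm := mul_le_mul_of_nonneg_left hR (by positivity : 0 ≤ c * Real.exp (c * l x))
    have hne := (Real.exp_pos (α * φ x)).ne'
    have e1 : c * Real.exp (c * l x) * (-Real.exp (α * φ x) *
        (c * deriv l x ^ 2 + c⁻¹ * κ * d ^ 2 * (Real.exp (α * φ x))⁻¹ ^ 2))
        = -(c * (Real.exp (c * l x) * (c * deriv l x)) * (Real.exp (α * φ x) * deriv l x))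
          - κ * d ^ 2 * Real.exp (c * l x) * (Real.exp (α * φ x))⁻¹ := by
      field_simp
      ring
    rw [e1] at hm
    simp only [div_eq_mul_inv]
    linear_combination hm
  · intro x hx
    refine (((hasDerivAt_sk κ _).comp x (hd3 x hx)).const_mul (-κ)).const_mul d |>.congr_deriv ?_
    field_simp
  · simp only [hs0, sub_zero, zero_mul, sk_zero, add_zero, hA]
    field_simp
    ring
  · simp only [← ha, sub_self, zero_mul, sk_zero, zero_add, hB]
    field_simp
    ring
end

section
/- Let d > 0, a ∈ ℝ, t ∈ (0,1), Λ ≥ 0, and let g : [0,d] → ℝ be a Lipschitz function with Lipschitz constant at most Λ. Then | ( ∫₀^{t·d} e^{−a·g(ξ)} dξ ) / ( t·∫₀^{d} e^{−a·g(ξ)} dξ ) − 1 | ≤ |a|·(1−t)·Λ·d·e^{|a|·(1−t)·Λ·d}. -/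
open Set intervalIntegral

theorem abs_exp_sub_one_le_abs_mul_exp_abs (x : ℝ) :
    |Real.exp x - 1| ≤ |x| * Real.exp |x| := by
  rcases le_total 0 x with hx | hx
  · rw [abs_of_nonneg hx, abs_of_nonneg (sub_nonneg.2 (Real.one_le_exp hx))]
    have h := mul_le_mul_of_nonneg_right (Real.add_one_le_exp (-x)) (Real.exp_pos x).le
    rw [← Real.exp_add, neg_add_cancel, Real.exp_zero] at h
    linarith
  · rw [abs_of_nonpos hx, abs_of_nonpos (sub_nonpos.2 (Real.exp_le_one_iff.2 hx))]
    have h := Real.add_one_le_exp x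
    have h' : -x * 1 ≤ -x * Real.exp (-x) :=
      mul_le_mul_of_nonneg_left (Real.one_le_exp (neg_nonneg.2 hx)) (neg_nonneg.2 hx)
    linarith

/-- The quantitative estimate of Appendix 6.1: if `g` is `Λ`-Lipschitz on `[0,d]`, then
`|(∫₀^{td} e^{-a g})/(t·∫₀^{d} e^{-a g}) − 1| ≤ |a|(1−t)Λd·e^{|a|(1−t)Λd}`,
which shows that the twisted coefficient tends to `1` as `d(x,y) → 0`. -/
theorem stmt_7 (d a t Λ : ℝ) (hd : 0 < d) (ht : t ∈ Ioo (0 : ℝ) 1) (hΛ : 0 ≤ Λ)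
    (g : ℝ → ℝ) (hg : LipschitzOnWith (Real.toNNReal Λ) g (Icc 0 d)) :
    |(∫ ξ in (0 : ℝ)..(t * d), Real.exp (-a * g ξ)) /
        (t * ∫ ξ in (0 : ℝ)..d, Real.exp (-a * g ξ)) - 1|
      ≤ |a| * (1 - t) * Λ * d * Real.exp (|a| * (1 - t) * Λ * d) := by
  obtain ⟨ht0, ht1⟩ := ht
  set C := |a| * (1 - t) * Λ * d with hC
  set F : ℝ → ℝ := fun ξ => Real.exp (-a * g ξ) with hF
  have hscale : ∀ x ∈ Icc 0 d, t * x ∈ Icc 0 d := fun x hx =>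
    ⟨mul_nonneg ht0.le hx.1, (mul_le_of_le_one_left hx.1 ht1.le).trans hx.2⟩
  have hFc : ContinuousOn F (Icc 0 d) :=
    Real.continuous_exp.comp_continuousOn (continuousOn_const.mul hg.continuousOn)
  have hFtc : ContinuousOn (fun x => F (t * x)) (Icc 0 d) :=
    hFc.comp (continuous_const_mul t).continuousOn hscale
  have hFi : IntervalIntegrable F MeasureTheory.volume 0 d :=
    hFc.intervalIntegrable_of_Icc hd.le
  have hFti : IntervalIntegrable (fun x => F (t * x)) MeasureTheory.volume 0 d :=
    hFtc.intervalIntegrable_of_Icc hd.le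
  have hpos : 0 < ∫ ξ in (0 : ℝ)..d, F ξ :=
    intervalIntegral_pos_of_pos hFi (fun _ => Real.exp_pos _) hd
  have hbound : ∀ x ∈ Icc 0 d, |F (t * x) - F x| ≤ C * Real.exp C * F x := by
    intro x hx
    have hdist := hg.dist_le_mul (t * x) (hscale x hx) x hx
    rw [Real.dist_eq, Real.dist_eq, Real.coe_toNNReal _ hΛ,
      show t * x - x = -((1 - t) * x) by ring, abs_neg,
      abs_of_nonneg (mul_nonneg (sub_nonneg.2 ht1.le) hx.1)] at hdist
    have hexp : |-a * (g (t * x) - g x)| ≤ C := by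
      rw [abs_mul, abs_neg]
      calc |a| * |g (t * x) - g x| ≤ |a| * (Λ * ((1 - t) * d)) := by
            refine mul_le_mul_of_nonneg_left (hdist.trans ?_) (abs_nonneg a)
            exact mul_le_mul_of_nonneg_left
              (mul_le_mul_of_nonneg_left hx.2 (sub_nonneg.2 ht1.le)) hΛ
        _ = C := by rw [hC]; ring
    have hfactor : F (t * x) - F x = (Real.exp (-a * (g (t * x) - g x)) - 1) * F x := by
      simp only [hF]
      rw [sub_mul, ← Real.exp_add, one_mul]
      ring_nf
    rw [hfactor, abs_mul, abs_of_pos (Real.exp_pos (-a * g x))]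
    refine mul_le_mul_of_nonneg_right ?_ (Real.exp_pos _).le
    exact (abs_exp_sub_one_le_abs_mul_exp_abs _).trans
      (mul_le_mul hexp (Real.exp_le_exp.2 hexp) (Real.exp_pos _).le
        ((abs_nonneg _).trans hexp))
  have hsubst : ∫ ξ in (0 : ℝ)..(t * d), F ξ = t * ∫ x in (0 : ℝ)..d, F (t * x) := by
    rw [mul_integral_comp_mul_left, mul_zero]
  rw [hsubst, mul_div_mul_left _ _ ht0.ne', div_sub_one hpos.ne', abs_div, abs_of_pos hpos,
    div_le_iff₀ hpos, ← integral_sub hFti hFi, ← integral_const_mul]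
  exact (abs_integral_le_integral_abs hd.le).trans
    (integral_mono_on hd.le (hFti.sub hFi).abs (hFi.const_mul _) hbound)
end

section
/- Let κ ∈ ℝ and let w : ℝ → (0,∞) be a smooth function. Then, as δ → 0⁺, 2·𝔰_κ( ∫₀^δ w(ξ) dξ ) / 𝔰_κ( ∫_{−δ}^{δ} w(ξ) dξ ) = 1 + ( w'(0)/(2·w(0)) )·δ + ( κ·w(0)²/2 )·δ² + O(δ³). -/
open Set Filter Asymptotics intervalIntegral

open scoped Topology

/-- A function vanishing at `0` whose derivative is `O(x ^ n)` is `O(x ^ (n + 1))`. -/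
theorem isBigO_pow_succ_of_hasDerivAt {f f' : ℝ → ℝ} {n : ℕ}
    (hf : ∀ x, HasDerivAt f (f' x) x) (h0 : f 0 = 0)
    (h : f' =O[𝓝 0] fun x : ℝ => x ^ n) : f =O[𝓝 0] fun x : ℝ => x ^ (n + 1) := by
  obtain ⟨C, hC0, hC⟩ := h.exists_nonneg
  obtain ⟨r, hr, hball⟩ := Metric.eventually_nhds_iff.1 hC.bound
  refine IsBigO.of_bound C (Metric.eventually_nhds_iff.2 ⟨r, hr, fun x hx => ?_⟩)
  have hx' : |x| < r := by simpa using hx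
  have hmem : ∀ y ∈ Icc (-|x|) |x|, ‖f' y‖ ≤ C * |x| ^ n := by
    intro y hy
    have hyx : |y| ≤ |x| := abs_le.2 hy
    have hb := hball (y := y) (by simpa using hyx.trans_lt hx')
    rw [norm_pow, Real.norm_eq_abs y] at hb
    exact hb.trans (by gcongr)
  have key := (convex_Icc (-|x|) |x|).norm_image_sub_le_of_norm_hasDerivWithin_le
    (fun y _ => (hf y).hasDerivWithinAt) hmem
    (⟨by simp, abs_nonneg x⟩ : (0 : ℝ) ∈ Icc (-|x|) |x|) (abs_le.1 le_rfl)
  rw [h0, sub_zero, sub_zero] at key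
  rw [norm_pow, pow_succ, ← mul_assoc]
  exact key

/-- Third order Taylor expansion at `0` of a function vanishing at `0`. -/
theorem taylor_three_isBigO {f f₁ f₂ f₃ : ℝ → ℝ} (h0 : f 0 = 0)
    (h₁ : ∀ x, HasDerivAt f (f₁ x) x) (h₂ : ∀ x, HasDerivAt f₁ (f₂ x) x)
    (h₃ : ∀ x, HasDerivAt f₂ (f₃ x) x) (h₄ : DifferentiableAt ℝ f₃ 0) :
    (fun x => f x - (f₁ 0 * x + f₂ 0 / 2 * x ^ 2 + f₃ 0 / 6 * x ^ 3))
      =O[𝓝 0] fun x : ℝ => x ^ 4 := by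
  have hf₃ : (fun x => f₃ x - f₃ 0) =O[𝓝 0] fun x : ℝ => x ^ 1 := by
    simpa using h₄.hasDerivAt.isBigO_sub
  have hf₂ : (fun x => f₂ x - (f₂ 0 + f₃ 0 * x)) =O[𝓝 0] fun x : ℝ => x ^ 2 := by
    refine isBigO_pow_succ_of_hasDerivAt (fun x => ?_) (by simp) hf₃
    exact (h₃ x).sub (by simpa using ((hasDerivAt_id x).const_mul (f₃ 0)).const_add (f₂ 0))
  have hf₁ : (fun x => f₁ x - (f₁ 0 + f₂ 0 * x + f₃ 0 / 2 * x ^ 2))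
      =O[𝓝 0] fun x : ℝ => x ^ 3 := by
    refine isBigO_pow_succ_of_hasDerivAt (fun x => ?_) (by simp) hf₂
    refine (h₂ x).sub ?_
    convert! (((hasDerivAt_id x).const_mul (f₂ 0)).const_add (f₁ 0)).add
      ((hasDerivAt_pow 2 x).const_mul (f₃ 0 / 2)) using 1
    norm_num
    ring
  refine isBigO_pow_succ_of_hasDerivAt (fun x => ?_) (by simp [h0]) hf₁
  refine (h₁ x).sub ?_
  convert! (((hasDerivAt_id x).const_mul (f₁ 0)).add
    ((hasDerivAt_pow 2 x).const_mul (f₂ 0 / 2))).add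
      ((hasDerivAt_pow 3 x).const_mul (f₃ 0 / 6)) using 1
  norm_num
  ring

theorem sk_sub_isBigO (κ : ℝ) :
    (fun s => sk κ s - (s - κ / 6 * s ^ 3)) =O[𝓝 0] fun s : ℝ => s ^ 4 := by
  rcases lt_trichotomy 0 κ with hκ | hκ | hκ
  · have hr : 0 < √κ := Real.sqrt_pos.2 hκ
    have hsq : √κ * √κ = κ := Real.mul_self_sqrt hκ.le
    have hlin (x : ℝ) : HasDerivAt (fun s => √κ * s) (√κ) x := by
      simpa using (hasDerivAt_id x).const_mul (√κ)
    have key := taylor_three_isBigO (f := fun s => Real.sin (√κ * s) / √κ)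
      (f₁ := fun s => Real.cos (√κ * s)) (f₂ := fun s => -√κ * Real.sin (√κ * s))
      (f₃ := fun s => -κ * Real.cos (√κ * s)) (by simp)
      (fun x => by
        convert! (hlin x).sin.div_const (√κ) using 1
        field_simp)
      (fun x => by
        convert! (hlin x).cos using 1
        ring)
      (fun x => by
        convert! (hlin x).sin.const_mul (-√κ) using 1
        linear_combination Real.cos (√κ * x) * hsq)
      (by fun_prop)
    refine key.congr_left fun s => ?_
    simp only [sk, if_pos hκ, mul_zero, Real.cos_zero, Real.sin_zero]
    ring
  · subst hκ
    simpa [sk] using isBigO_zero _ _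
  · have hr : 0 < √|κ| := Real.sqrt_pos.2 (abs_pos.2 hκ.ne)
    have hsq : √|κ| * √|κ| = -κ := by
      rw [Real.mul_self_sqrt (abs_nonneg κ), abs_of_neg hκ]
    have hlin (x : ℝ) : HasDerivAt (fun s => √|κ| * s) (√|κ|) x := by
      simpa using (hasDerivAt_id x).const_mul (√|κ|)
    have key := taylor_three_isBigO (f := fun s => Real.sinh (√|κ| * s) / √|κ|)
      (f₁ := fun s => Real.cosh (√|κ| * s)) (f₂ := fun s => √|κ| * Real.sinh (√|κ| * s))
      (f₃ := fun s => -κ * Real.cosh (√|κ| * s)) (by simp)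
      (fun x => by
        convert! (hlin x).sinh.div_const (√|κ|) using 1
        field_simp)
      (fun x => by
        convert! (hlin x).cosh using 1
        ring)
      (fun x => by
        convert! (hlin x).sinh.const_mul (√|κ|) using 1
        linear_combination -Real.cosh (√|κ| * x) * hsq)
      (by fun_prop)
    refine key.congr_left fun s => ?_
    simp only [sk, if_neg hκ.not_gt, if_neg hκ.ne, mul_zero, Real.cosh_zero, Real.sinh_zero]
    ring

theorem integral_sub_isBigO {w : ℝ → ℝ} (hw : ContDiff ℝ 3 w) :
    (fun x => (∫ ξ in (0 : ℝ)..x, w ξ)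
        - (w 0 * x + deriv w 0 / 2 * x ^ 2 + deriv (deriv w) 0 / 6 * x ^ 3))
      =O[𝓝 0] fun x : ℝ => x ^ 4 := by
  have hw₁ : ContDiff ℝ 2 (deriv w) := by
    have : ContDiff ℝ (2 + 1) w := by norm_num; exact hw
    exact (contDiff_succ_iff_deriv.1 this).2.2
  have hw₂ : ContDiff ℝ 1 (deriv (deriv w)) := by
    have : ContDiff ℝ (1 + 1) (deriv w) := by norm_num; exact hw₁
    exact (contDiff_succ_iff_deriv.1 this).2.2
  exact taylor_three_isBigO integral_same
    (fun x => (hw.continuous.integral_hasStrictDerivAt 0 x).hasDerivAt)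
    (fun x => (hw.differentiable (by norm_num) x).hasDerivAt)
    (fun x => (hw₁.differentiable (by norm_num) x).hasDerivAt)
    (hw₂.differentiable (by norm_num) 0)

/-- Composition of `sk κ` with a function having a third order expansion without constant term. -/
theorem sk_comp_sub_isBigO (κ a b c : ℝ) {F : ℝ → ℝ}
    (hF : (fun x => F x - (a * x + b * x ^ 2 + c * x ^ 3)) =O[𝓝 0] fun x : ℝ => x ^ 4) :
    (fun x => sk κ (F x) - (a * x + b * x ^ 2 + (c - κ * a ^ 3 / 6) * x ^ 3))
      =O[𝓝 0] fun x : ℝ => x ^ 4 := by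
  have hF₂ : (fun x => F x - a * x) =O[𝓝 0] fun x : ℝ => x ^ 2 := by
    refine (((hF.trans ((isLittleO_pow_pow (by norm_num)).isBigO)).add
      ((isBigO_refl _ _).const_mul_left b)).add
      (((isLittleO_pow_pow (show 2 < 3 by norm_num)).isBigO).const_mul_left c)).congr_left fun x => ?_
    ring
  have hid : (fun x : ℝ => x) =O[𝓝 0] fun x : ℝ => x ^ 1 := by simpa using isBigO_refl _ _
  have hF₁ : F =O[𝓝 0] fun x : ℝ => x ^ 1 := by
    refine ((hF₂.trans ((isLittleO_pow_pow (by norm_num)).isBigO)).add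
      (hid.const_mul_left a)).congr_left fun x => ?_
    ring
  have hF0 : Tendsto F (𝓝 0) (𝓝 0) :=
    hF₁.trans_tendsto (by simpa using (continuous_pow 1).tendsto (0 : ℝ))
  have hs : (fun x => sk κ (F x) - (F x - κ / 6 * F x ^ 3)) =O[𝓝 0] fun x : ℝ => x ^ 4 :=
    ((sk_sub_isBigO κ).comp_tendsto hF0).trans (by simpa [Function.comp_def] using hF₁.pow 4)
  have hax : (fun x => a * x) =O[𝓝 0] fun x : ℝ => x ^ 1 := hid.const_mul_left a
  have hcube : (fun x => F x ^ 3 - (a * x) ^ 3) =O[𝓝 0] fun x : ℝ => x ^ 4 := by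
    have hq : (fun x => F x * F x + F x * (a * x) + a * x * (a * x))
        =O[𝓝 0] fun x : ℝ => x ^ 1 * x ^ 1 :=
      ((hF₁.mul hF₁).add (hF₁.mul hax)).add (hax.mul hax)
    refine (hF₂.mul hq).congr (fun x => ?_) fun x => ?_ <;> ring
  refine ((hs.add hF).sub (hcube.const_mul_left (κ / 6))).congr_left fun x => ?_
  ring

/-- Taylor expansion from Appendix 6.2: for smooth positive `w`, as `δ → 0⁺`,
`2𝔰_κ(∫₀^δ w)/𝔰_κ(∫_{−δ}^{δ} w) = 1 + (w'(0)/(2w(0)))δ + (κw(0)²/2)δ² + O(δ³)`. -/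
theorem stmt_9 (κ : ℝ) (w : ℝ → ℝ) (hw : ContDiff ℝ (⊤ : ℕ∞) w) (hwpos : ∀ x, 0 < w x) :
    (fun δ : ℝ =>
        2 * sk κ (∫ ξ in (0 : ℝ)..δ, w ξ) / sk κ (∫ ξ in (-δ)..δ, w ξ)
          - (1 + (deriv w 0 / (2 * w 0)) * δ + (κ * (w 0) ^ 2 / 2) * δ ^ 2))
      =O[nhdsWithin 0 (Ioi 0)] (fun δ : ℝ => δ ^ 3) := by
  have ha : w 0 ≠ 0 := (hwpos 0).ne'
  have hF := integral_sub_isBigO (hw.of_le (WithTop.coe_le_coe.2 le_top) : ContDiff ℝ 3 w)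
  have hFneg := hF.comp_tendsto (k := fun x : ℝ => -x) (l' := 𝓝 0)
    (by simpa using (continuous_neg.tendsto (0 : ℝ)))
  have hG : (fun x => (∫ ξ in (-x)..x, w ξ)
      - (2 * w 0 * x + 0 * x ^ 2 + deriv (deriv w) 0 / 3 * x ^ 3))
      =O[𝓝 0] fun x : ℝ => x ^ 4 := by
    refine (hF.sub (hFneg.congr_right (g₂ := fun x : ℝ => x ^ 4) fun x => ?_)).congr_left
      fun x => ?_
    · simp only [Function.comp]
      ring
    · have := integral_interval_sub_left (hw.continuous.intervalIntegrable 0 x)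
        (hw.continuous.intervalIntegrable (μ := MeasureTheory.volume) 0 (-x))
      simp only [Function.comp]
      rw [← this]
      ring
  have hN := sk_comp_sub_isBigO κ _ _ _ hF
  have hD := sk_comp_sub_isBigO κ _ _ _ hG
  set a := w 0
  set b := deriv w 0
  set c := deriv (deriv w) 0
  set N : ℝ → ℝ := fun x => sk κ (∫ ξ in (0 : ℝ)..x, w ξ)
  set D : ℝ → ℝ := fun x => sk κ (∫ ξ in (-x)..x, w ξ)
  set P : ℝ → ℝ := fun x => 1 + b / (2 * a) * x + κ * a ^ 2 / 2 * x ^ 2 with hP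
  have hbdd {g : ℝ → ℝ} (hg : Continuous g) : g =O[𝓝 0] fun _ : ℝ => (1 : ℝ) :=
    hg.continuousAt.isBigO_one ℝ
  have hnum : (fun x => 2 * N x - P x * D x) =O[𝓝 0] fun x : ℝ => x ^ 4 := by
    have hPD := ((hbdd (g := P) (by fun_prop)).mul hD).congr_right fun x => one_mul _
    have hrest := ((hbdd (g := fun x : ℝ => (b / (2 * a) + κ * a ^ 2 / 2 * x) *
      (c / 3 - κ * (2 * a) ^ 3 / 6)) (by fun_prop)).mul
      (isBigO_refl (fun x : ℝ => x ^ 4) (𝓝 0))).congr_right fun x => one_mul _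
    refine (((hN.const_mul_left 2).sub hPD).sub hrest).congr_left fun x => ?_
    simp only [hP]
    field_simp
    ring
  have hDlow : (fun x : ℝ => x) =O[𝓝 0] D := by
    have hlin : (fun x => D x - 2 * a * x) =o[𝓝 0] fun x : ℝ => 2 * a * x := by
      have h2 : (fun x => D x - 2 * a * x) =O[𝓝 0] fun x : ℝ => x ^ 2 := by
        refine ((hD.trans ((isLittleO_pow_pow (by norm_num)).isBigO)).add
          (((isLittleO_pow_pow (show 2 < 3 by norm_num)).isBigO).const_mul_left
            (c / 3 - κ * (2 * a) ^ 3 / 6))).congr_left fun x => ?_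
        ring
      refine h2.trans_isLittleO ?_
      exact (isLittleO_const_mul_right_iff (by simpa using ha)).2 (isLittleO_pow_id one_lt_two)
    exact ((isBigO_refl _ _).const_mul_right (by simpa using ha)).trans
      (IsEquivalent.isBigO_symm hlin)
  have hDinv : (fun x => (D x)⁻¹) =O[𝓝[>] 0] fun x : ℝ => x⁻¹ :=
    (hDlow.mono nhdsWithin_le_nhds).inv_rev
      (eventually_mem_nhdsWithin.mono fun x hx h => absurd h (ne_of_gt hx))
  have hDne : ∀ᶠ x in 𝓝[>] (0 : ℝ), D x ≠ 0 := by
    filter_upwards [(hDlow.mono nhdsWithin_le_nhds).eq_zero_imp, eventually_mem_nhdsWithin]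
      with x hx hpos h
    exact (ne_of_gt hpos) (hx h)
  refine ((hnum.mono nhdsWithin_le_nhds).mul hDinv).congr' ?_ ?_
  · filter_upwards [hDne] with x hx
    change (2 * N x - P x * D x) * (D x)⁻¹ = 2 * N x / D x - P x
    field_simp
  · filter_upwards [eventually_mem_nhdsWithin] with x hx
    have : x ≠ 0 := ne_of_gt hx
    field_simp
end
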